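/- arXiv:2301.09603 — 2 statements merged into one kernel-verified Lean document; each statement's English description precedes it below -/
import Mathlib

section
/- Let Ω ⊆ ℝ^d (d ≥ 1) be an open set, T > 0, and let (d+1)/d ≤ r < ∞. Let η ∈ L^r_loc(Ω×(0,T)) and Q ∈ L^r_loc(Ω×(0,T); ℝ^d), and let D be a positive locally finite Borel measure on Ω×(0,T) such that for every φ ∈ C^∞_c(Ω×(0,T)): ∫₀^T∫_Ω [ η ∂_tφ + Q·∇φ ] dx dt = ∫ φ dD (i.e. ∂_t η + div Q = −D in the sense of distributions). Set s = d + 1 − r/(r−1). Then for every Borel set B compactly contained in Ω×(0,T), H^s(B) < ∞ implies D(B) = 0. In particular, if D is non-trivial and concentrated on a space-time set S, then the Hausdorff dimension of S is at least s. -/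
open MeasureTheory Metric Set Filter Topology ENNReal

noncomputable section

/-- Euclidean space `ℝ^d`. -/
abbrev Euc (d : ℕ) : Type := EuclideanSpace ℝ (Fin d)

/-- Local `L^r` integrability on the space-time domain `Ω × (0,T)`. -/
def MemLocLp {d : ℕ} {F : Type*} [NormedAddCommGroup F] (Ω : Set (Euc d)) (T : ℝ)
    (f : Euc d × ℝ → F) (r : ℝ≥0∞) : Prop :=
  AEStronglyMeasurable f (volume.restrict (Ω ×ˢ Set.Ioo 0 T)) ∧
  ∀ K : Set (Euc d × ℝ), IsCompact K → K ⊆ Ω ×ˢ Set.Ioo 0 T →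
    eLpNorm f r (volume.restrict K) < ⊤

/-- `D` is a positive locally finite entropy production (anomalous dissipation) measure for
the entropy/entropy-flux pair `(η, Q)` on `Ω × (0,T)`: for every `φ ∈ C^∞_c(Ω × (0,T))`,
`∫∫ [ η ∂_t φ + Q·∇φ ] dx dt = ∫ φ dD`, i.e. `∂_t η + div Q = -D` distributionally. -/
def IsEntropyDissipation {d : ℕ} (Ω : Set (Euc d)) (T : ℝ) (η : Euc d × ℝ → ℝ)
    (Q : Euc d × ℝ → Euc d) (D : Measure (Euc d × ℝ)) : Prop :=
  (∀ K : Set (Euc d × ℝ), IsCompact K → K ⊆ Ω ×ˢ Set.Ioo 0 T → D K < ⊤) ∧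
  D ((Ω ×ˢ Set.Ioo 0 T)ᶜ) = 0 ∧
  ∀ φ : Euc d × ℝ → ℝ, ContDiff ℝ (⊤ : ℕ∞) φ → HasCompactSupport φ →
    tsupport φ ⊆ Ω ×ˢ Set.Ioo 0 T →
    ∫ z in Ω ×ˢ Set.Ioo 0 T,
        (η z * (fderiv ℝ φ z) (0, 1) + (fderiv ℝ φ z) (Q z, 0)) =
      ∫ z, φ z ∂D

/-- A compact set of finite `s`-dimensional Hausdorff measure is covered by finitely many small
balls centred on it, with controlled sum of `s`-th powers of the radii. -/
lemma IsCompact.exists_finset_cover_sum_rpow_le {X : Type*} [MetricSpace X] [MeasurableSpace X]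
    [BorelSpace X] [Nonempty X] {K : Set X} (hK : IsCompact K) {s : ℝ} (hs : 0 ≤ s) (hfin : μH[s] K < ⊤)
    {δ : ℝ} (hδ : 0 < δ) :
    ∃ (t : Finset ℕ) (x : ℕ → X) (ρ : ℕ → ℝ), (∀ i ∈ t, x i ∈ K ∧ 0 < ρ i ∧ ρ i < δ) ∧
      K ⊆ ⋃ i ∈ t, closedBall (x i) (ρ i) ∧
      ∑ i ∈ t, ENNReal.ofReal (ρ i) ^ s ≤ μH[s] K + 2 := by
  obtain ⟨x₀⟩ := ‹Nonempty X›
  have hlt : μH[s] K < μH[s] K + 1 := ENNReal.lt_add_right hfin.ne one_ne_zero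
  have hle : (⨅ (t : ℕ → Set X) (_ : K ⊆ ⋃ n, t n)
      (_ : ∀ n, ediam (t n) ≤ ENNReal.ofReal (δ / 2)),
      ∑' n, ⨆ _ : (t n).Nonempty, ediam (t n) ^ s) ≤ μH[s] K := by
    rw [Measure.hausdorffMeasure_apply s K]
    exact le_iSup₂_of_le (ENNReal.ofReal (δ / 2)) (by simpa using half_pos hδ) le_rfl
  have hlt' := hle.trans_lt hlt
  simp only [iInf_lt_iff] at hlt'
  obtain ⟨t, hcov, hdiam, hsum⟩ := hlt'
  obtain ⟨ε, hε, hεsum⟩ := ENNReal.exists_pos_sum_of_countable' (ε := 1) one_ne_zero ℕ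
  have hchoose : ∀ n, ∃ (x : X) (ρ : ℝ), (t n ∩ K).Nonempty →
      x ∈ K ∧ 0 < ρ ∧ ρ < δ ∧ t n ⊆ ball x ρ ∧
        ENNReal.ofReal ρ ^ s ≤ (⨆ _ : (t n).Nonempty, ediam (t n) ^ s) + ε n := by
    intro n
    by_cases hn : (t n ∩ K).Nonempty
    swap
    · exact ⟨x₀, 0, fun h => absurd h hn⟩
    obtain ⟨x, hxt, hxK⟩ := hn
    have hdtop : ediam (t n) ≠ ⊤ := ne_top_of_le_ne_top ENNReal.ofReal_ne_top (hdiam n)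
    have hptop : ediam (t n) ^ s ≠ ⊤ := ENNReal.rpow_ne_top_of_nonneg hs hdtop
    have hcont : Tendsto (fun y : ℝ≥0∞ => y ^ s) (𝓝[>] ediam (t n)) (𝓝 (ediam (t n) ^ s)) :=
      (ENNReal.continuous_rpow_const.tendsto _).mono_left nhdsWithin_le_nhds
    have hlt₁ : ediam (t n) < ENNReal.ofReal δ :=
      (hdiam n).trans_lt ((ENNReal.ofReal_lt_ofReal_iff hδ).2 (half_lt_self hδ))
    have hev := (hcont.eventually_lt_const (ENNReal.lt_add_right hptop (hε n).ne')).and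
      (Ioo_mem_nhdsGT hlt₁)
    have : (𝓝[>] ediam (t n)).NeBot := nhdsGT_neBot_of_exists_gt ⟨_, hlt₁⟩
    obtain ⟨y, hy, hy₁, hy₂⟩ := hev.exists
    have hytop : y ≠ ⊤ := hy₂.ne_top
    refine ⟨x, y.toReal, fun _ => ⟨hxK, ENNReal.toReal_pos (pos_of_gt hy₁).ne' hytop,
      ENNReal.toReal_lt_of_lt_ofReal hy₂, fun z hz => ?_, ?_⟩⟩
    · rw [mem_ball, ← ENNReal.ofReal_lt_ofReal_iff (ENNReal.toReal_pos (pos_of_gt hy₁).ne' hytop),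
        ENNReal.ofReal_toReal hytop, ← edist_dist]
      exact (edist_le_ediam_of_mem hz hxt).trans_lt hy₁
    · rw [ENNReal.ofReal_toReal hytop, iSup_pos ⟨x, hxt⟩]
      exact hy.le
  choose x ρ h using hchoose
  obtain ⟨b, hb, hbfin, hKb⟩ := hK.elim_finite_subcover_image (b := {n | (t n ∩ K).Nonempty})
    (c := fun n => ball (x n) (ρ n)) (fun _ _ => isOpen_ball) (fun z hz => by
      obtain ⟨n, hn⟩ := mem_iUnion.1 (hcov hz)
      exact mem_iUnion₂.2 ⟨n, ⟨z, hn, hz⟩, (h n ⟨z, hn, hz⟩).2.2.2.1 hn⟩)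
  refine ⟨hbfin.toFinset, x, ρ, fun i hi => ?_, fun z hz => ?_, ?_⟩
  · have := h i (hb (hbfin.mem_toFinset.1 hi))
    exact ⟨this.1, this.2.1, this.2.2.1⟩
  · obtain ⟨n, hn, hzn⟩ := mem_iUnion₂.1 (hKb hz)
    exact mem_iUnion₂.2 ⟨n, hbfin.mem_toFinset.2 hn, ball_subset_closedBall hzn⟩
  · calc ∑ i ∈ hbfin.toFinset, ENNReal.ofReal (ρ i) ^ s
        ≤ ∑ i ∈ hbfin.toFinset, ((⨆ _ : (t i).Nonempty, ediam (t i) ^ s) + ε i) :=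
          Finset.sum_le_sum fun i hi => (h i (hb (hbfin.mem_toFinset.1 hi))).2.2.2.2
      _ ≤ ∑' i, ((⨆ _ : (t i).Nonempty, ediam (t i) ^ s) + ε i) := ENNReal.sum_le_tsum _
      _ = ∑' i, (⨆ _ : (t i).Nonempty, ediam (t i) ^ s) + ∑' i, ε i := ENNReal.tsum_add
      _ ≤ (μH[s] K + 1) + 1 := add_le_add hsum.le hεsum.le
      _ = μH[s] K + 2 := by rw [add_assoc, one_add_one_eq_two]

/-- A smooth cut-off function equal to `1` on a finite union of balls whose gradient is controlled
in `L^p` by a constant independent of the number of balls and of their overlap. -/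
lemma exists_smooth_cutoff_of_balls {E : Type*} [NormedAddCommGroup E] [NormedSpace ℝ E]
    [FiniteDimensional ℝ E] {p q : ℝ} (hpq : p.HolderConjugate q) :
    ∃ C : ℝ, 0 ≤ C ∧ ∀ {ι : Type} (t : Finset ι) (x : ι → E) (ρ : ι → ℝ), (∀ i ∈ t, 0 < ρ i) →
      ∃ φ : E → ℝ, ContDiff ℝ (⊤ : ℕ∞) φ ∧ (∀ z, 0 ≤ φ z) ∧
        (∀ z ∈ ⋃ i ∈ t, closedBall (x i) (ρ i), φ z = 1) ∧
        tsupport φ ⊆ ⋃ i ∈ t, closedBall (x i) (2 * ρ i) ∧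
        ∀ z, ‖fderiv ℝ φ z‖ ^ p ≤
          C * ∑ i ∈ t, (closedBall (x i) (2 * ρ i)).indicator (fun _ => (ρ i)⁻¹ ^ p) z := by
  let ψ : ContDiffBump (0 : E) := ⟨1, 2, one_pos, one_lt_two⟩
  have hψd : ContDiff ℝ (⊤ : ℕ∞) ψ := ψ.contDiff
  obtain ⟨A, hA⟩ := (ψ.hasCompactSupport.fderiv (𝕜 := ℝ)).exists_bound_of_continuous
    (hψd.continuous_fderiv (by simp))
  have hA0 : 0 ≤ A := (norm_nonneg _).trans (hA 0)
  have hHd : ContDiff ℝ (⊤ : ℕ∞) Real.smoothTransition := Real.smoothTransition.contDiff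
  obtain ⟨L, hL⟩ := (isCompact_Icc (a := (0 : ℝ)) (b := 1)).exists_bound_of_continuousOn
    (hHd.continuous_deriv (by simp)).continuousOn
  have hL0 : 0 ≤ L := (norm_nonneg _).trans (hL 0 (by simp))
  obtain ⟨m, hm⟩ := exists_nat_gt p
  have hp : 1 < p := hpq.lt
  have hm1 : 1 ≤ m := by
    have : (1 : ℝ) < m := hp.trans hm
    exact_mod_cast this.le
  have hmq : (m : ℝ) ≤ ((m - 1 : ℕ) : ℝ) * q := by
    rw [Nat.cast_sub hm1, Nat.cast_one]
    have h1 := hpq.sub_one_mul_conj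
    have h2 := hpq.mul_eq_add
    have h3 := hpq.symm.lt
    nlinarith
  refine ⟨(L * (m * A)) ^ p, by positivity, fun {ι} t x ρ hρ => ?_⟩
  let f : ι → E → ℝ := fun i z => ψ ((ρ i)⁻¹ • (z - x i))
  have hf0 : ∀ i z, 0 ≤ f i z := fun i z => ψ.nonneg
  have hf1 : ∀ i z, f i z ≤ 1 := fun i z => ψ.le_one
  have hfd : ∀ i, ContDiff ℝ (⊤ : ℕ∞) (f i) := fun i =>
    hψd.comp ((contDiff_id.sub contDiff_const).const_smul _)
  have hnorm : ∀ i ∈ t, ∀ z, ‖(ρ i)⁻¹ • (z - x i)‖ = dist z (x i) / ρ i := fun i hi z => by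
    rw [norm_smul, Real.norm_of_nonneg (inv_nonneg.2 (hρ i hi).le), dist_eq_norm]
    ring
  have hfball : ∀ i ∈ t, ∀ z ∈ closedBall (x i) (ρ i), f i z = 1 := fun i hi z hz => by
    refine ψ.one_of_mem_closedBall ?_
    rw [mem_closedBall_zero_iff, hnorm i hi]
    exact (div_le_one (hρ i hi)).2 hz
  have hfzero : ∀ i ∈ t, ∀ z ∉ closedBall (x i) (2 * ρ i), f i z = 0 := fun i hi z hz => by
    refine ψ.zero_of_le_dist ?_
    rw [dist_zero_right, hnorm i hi]
    exact (le_div_iff₀ (hρ i hi)).2 (not_le.1 hz).le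
  let a : ι → E → ℝ := fun i => (closedBall (x i) (2 * ρ i)).indicator (fun _ => (ρ i)⁻¹)
  have ha0 : ∀ i ∈ t, ∀ z, 0 ≤ a i z := fun i hi z =>
    indicator_nonneg (fun _ _ => inv_nonneg.2 (hρ i hi).le) z
  have hfa : ∀ i ∈ t, ∀ z, ‖fderiv ℝ (f i) z‖ ≤ A * a i z := by
    intro i hi z
    by_cases hz : z ∈ closedBall (x i) (2 * ρ i)
    · have hin : HasFDerivAt (fun z => (ρ i)⁻¹ • (z - x i))
          ((ρ i)⁻¹ • ContinuousLinearMap.id ℝ E) z := ((hasFDerivAt_id z).sub_const _).const_smul _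
      have hout := ((hψd.differentiable (by simp)) ((ρ i)⁻¹ • (z - x i))).hasFDerivAt
      have hc := HasFDerivAt.comp (g := ψ) z hout hin
      rw [show fderiv ℝ (f i) z = _ from hc.fderiv]
      simp only [a, indicator_of_mem hz]
      refine (ContinuousLinearMap.opNorm_comp_le _ _).trans ?_
      refine mul_le_mul (hA _) ?_ (norm_nonneg _) hA0
      rw [norm_smul, Real.norm_of_nonneg (inv_nonneg.2 (hρ i hi).le)]
      exact mul_le_of_le_one_right (inv_nonneg.2 (hρ i hi).le) ContinuousLinearMap.norm_id_le
    · have : f i =ᶠ[𝓝 z] fun _ => (0 : ℝ) := by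
        filter_upwards [isClosed_closedBall.isOpen_compl.mem_nhds hz] with w hw
        exact hfzero i hi w hw
      rw [this.fderiv_eq]
      simp only [a, indicator_of_notMem hz]
      simp
  let G : E → ℝ := fun z => ∑ i ∈ t, f i z ^ m
  have hGd : ContDiff ℝ (⊤ : ℕ∞) G := ContDiff.sum fun i _ => (hfd i).pow m
  have hG' : ∀ z, HasFDerivAt G
      (∑ i ∈ t, ((m : ℝ) * f i z ^ (m - 1)) • fderiv ℝ (f i) z) z := fun z => by
    refine HasFDerivAt.fun_sum fun i _ => ?_
    have := (((hfd i).differentiable (by simp)) z).hasFDerivAt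
    simpa using this.pow m
  refine ⟨fun z => Real.smoothTransition (G z), hHd.comp hGd,
    fun z => Real.smoothTransition.nonneg _, fun z hz => ?_, ?_, fun z => ?_⟩
  · obtain ⟨i, hi, hzi⟩ := mem_iUnion₂.1 hz
    refine Real.smoothTransition.one_of_one_le ?_
    calc (1 : ℝ) = f i z ^ m := by rw [hfball i hi z hzi, one_pow]
      _ ≤ G z := Finset.single_le_sum (f := fun i => f i z ^ m)
        (fun j _ => pow_nonneg (hf0 j z) m) hi
  · refine closure_minimal (fun z hz => ?_)
      (t.finite_toSet.isClosed_biUnion fun i _ => isClosed_closedBall)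
    by_contra hcon
    refine hz (Real.smoothTransition.zero_of_nonpos (le_of_eq ?_))
    refine Finset.sum_eq_zero fun i hi => ?_
    rw [hfzero i hi z fun h => hcon (mem_iUnion₂.2 ⟨i, hi, h⟩), zero_pow (by lia)]
  · have hsum : ∑ i ∈ t, (closedBall (x i) (2 * ρ i)).indicator (fun _ => (ρ i)⁻¹ ^ p) z =
        ∑ i ∈ t, a i z ^ p := Finset.sum_congr rfl fun i _ => by
      by_cases hz : z ∈ closedBall (x i) (2 * ρ i)
      · simp only [a, indicator_of_mem hz]
      · simp only [a, indicator_of_notMem hz, Real.zero_rpow hpq.ne_zero]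
    have hS0 : 0 ≤ ∑ i ∈ t, a i z ^ p :=
      Finset.sum_nonneg fun i hi => Real.rpow_nonneg (ha0 i hi z) p
    rw [hsum]
    have hφ' := ((hHd.differentiable (by simp)) (G z)).hasDerivAt.comp_hasFDerivAt z (hG' z)
    have hφ'' : fderiv ℝ (fun z => Real.smoothTransition (G z)) z = _ := hφ'.fderiv
    rw [hφ'', norm_smul]
    obtain hG1 | hG1 := lt_or_ge 1 (G z)
    · have : deriv Real.smoothTransition (G z) = 0 := by
        have : Real.smoothTransition =ᶠ[𝓝 (G z)] fun _ => (1 : ℝ) := by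
          filter_upwards [lt_mem_nhds hG1] with y hy
          exact Real.smoothTransition.one_of_one_le hy.le
        rw [this.deriv_eq, deriv_const]
      rw [this, norm_zero, zero_mul, Real.zero_rpow hpq.ne_zero]
      positivity
    have hG0 : 0 ≤ G z := Finset.sum_nonneg fun i _ => pow_nonneg (hf0 i z) m
    have hholder : ∑ i ∈ t, a i z * f i z ^ (m - 1) ≤ (∑ i ∈ t, a i z ^ p) ^ (1 / p) := by
      refine (Real.inner_le_Lp_mul_Lq t _ _ hpq).trans ?_
      have h1 : ∑ i ∈ t, |a i z| ^ p = ∑ i ∈ t, a i z ^ p :=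
        Finset.sum_congr rfl fun i hi => by rw [abs_of_nonneg (ha0 i hi z)]
      have h2 : ∑ i ∈ t, |f i z ^ (m - 1)| ^ q ≤ 1 := by
        refine le_trans (Finset.sum_le_sum fun i _ => ?_) hG1
        rw [abs_of_nonneg (pow_nonneg (hf0 i z) _), ← Real.rpow_natCast, ← Real.rpow_mul (hf0 i z),
          ← Real.rpow_natCast]
        exact Real.rpow_le_rpow_of_exponent_ge' (hf0 i z) (hf1 i z) (Nat.cast_nonneg m) hmq
      rw [h1]
      refine mul_le_of_le_one_right (Real.rpow_nonneg hS0 _) (Real.rpow_le_one ?_ h2 ?_)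
      · exact Finset.sum_nonneg fun i _ => Real.rpow_nonneg (abs_nonneg _) _
      · exact one_div_nonneg.2 hpq.symm.nonneg
    have hgrad : ‖∑ i ∈ t, ((m : ℝ) * f i z ^ (m - 1)) • fderiv ℝ (f i) z‖ ≤
        m * A * (∑ i ∈ t, a i z ^ p) ^ (1 / p) := by
      refine (norm_sum_le _ _).trans ?_
      refine le_trans (Finset.sum_le_sum fun i hi => ?_)
        ((Finset.mul_sum _ _ _).symm.le.trans (mul_le_mul_of_nonneg_left hholder (by positivity)))
      rw [norm_smul, Real.norm_of_nonneg (mul_nonneg (Nat.cast_nonneg m) (pow_nonneg (hf0 i z) _))]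
      calc (m : ℝ) * f i z ^ (m - 1) * ‖fderiv ℝ (f i) z‖
          ≤ (m : ℝ) * f i z ^ (m - 1) * (A * a i z) := mul_le_mul_of_nonneg_left (hfa i hi z)
            (mul_nonneg (Nat.cast_nonneg m) (pow_nonneg (hf0 i z) _))
        _ = m * A * (a i z * f i z ^ (m - 1)) := by ring
    calc _ ≤ (L * (m * A * (∑ i ∈ t, a i z ^ p) ^ (1 / p))) ^ p := by
          refine Real.rpow_le_rpow (by positivity) ?_ hpq.nonneg
          exact mul_le_mul (hL _ ⟨hG0, hG1⟩) hgrad (norm_nonneg _) hL0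
      _ = (L * (m * A)) ^ p * ∑ i ∈ t, a i z ^ p := by
          rw [← mul_assoc, Real.mul_rpow (by positivity) (by positivity), ← Real.rpow_mul hS0,
            one_div_mul_cancel hpq.ne_zero, Real.rpow_one]

/-- Capacity estimate: a measure `D` dominated, when tested against smooth cut-offs, by
`∫ ‖∇φ‖ g` with `g ∈ L^q_loc` does not charge compact sets of finite `(n - p)`-dimensional
Hausdorff measure, where `p` is the exponent conjugate to `q`. -/
lemma IsCompact.measure_eq_zero_of_hausdorffMeasure_lt_top {E : Type*} [NormedAddCommGroup E]
    [NormedSpace ℝ E] [FiniteDimensional ℝ E] [MeasurableSpace E] [BorelSpace E]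
    (μ : Measure E) [μ.IsAddHaarMeasure] {p q : ℝ} (hpq : p.HolderConjugate q)
    (hp : p ≤ Module.finrank ℝ E) {U : Set E} (hU : IsOpen U) {g : E → ℝ≥0∞}
    (hg : AEMeasurable g (μ.restrict U))
    (hgq : ∀ K, IsCompact K → K ⊆ U → ∫⁻ z in K, g z ^ q ∂μ < ⊤) {D : Measure E}
    (hDfin : ∀ K, IsCompact K → K ⊆ U → D K < ⊤)
    (hD : ∀ φ : E → ℝ, ContDiff ℝ (⊤ : ℕ∞) φ → HasCompactSupport φ → tsupport φ ⊆ U →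
      ENNReal.ofReal (∫ z, φ z ∂D) ≤ ∫⁻ z in U, ‖fderiv ℝ φ z‖ₑ * g z ∂μ)
    {K : Set E} (hK : IsCompact K) (hKU : K ⊆ U)
    (hfin : μH[(Module.finrank ℝ E : ℝ) - p] K < ⊤) : D K = 0 := by
  have : ProperSpace E := FiniteDimensional.proper ℝ E
  set n := Module.finrank ℝ E with hn
  obtain ⟨C, hC0, hC⟩ := exists_smooth_cutoff_of_balls (E := E) hpq
  have hμK : μ K = 0 := by
    refine Measure.absolutelyContinuous_isAddHaarMeasure μ μH[(n : ℝ)] ?_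
    exact (Measure.hausdorffMeasure_zero_or_top (sub_lt_self _ hpq.pos) K).resolve_right hfin.ne
  obtain ⟨δ₀, hδ₀, hδ₀U⟩ := hK.exists_cthickening_subset_open hU hKU
  let ν : Measure E := (μ.restrict (cthickening δ₀ K)).withDensity fun z => g z ^ q
  have : IsFiniteMeasure ν := isFiniteMeasure_withDensity (hgq _ hK.cthickening hδ₀U).ne
  have hνK : ν K = 0 :=
    withDensity_absolutelyContinuous _ _ (Measure.absolutelyContinuous_of_le
      Measure.restrict_le_self hμK)
  have hν : ∀ δ ≤ δ₀, ν (cthickening δ K) = ∫⁻ z in cthickening δ K, g z ^ q ∂μ := fun δ hδ => by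
    rw [withDensity_apply _ isClosed_cthickening.measurableSet,
      Measure.restrict_restrict isClosed_cthickening.measurableSet,
      inter_eq_left.2 (cthickening_mono hδ K)]
  let W : ℝ≥0∞ := (ENNReal.ofReal (C * 2 ^ n) * μ (ball 0 1) * (μH[(n : ℝ) - p] K + 2)) ^ (1 / p)
  have hW : W ≠ ⊤ := ENNReal.rpow_ne_top_of_nonneg (one_div_nonneg.2 hpq.nonneg)
    (ENNReal.mul_ne_top (ENNReal.mul_ne_top ENNReal.ofReal_ne_top measure_ball_lt_top.ne)
      (ENNReal.add_ne_top.2 ⟨hfin.ne, ENNReal.ofNat_ne_top⟩))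
  have hmain : ∀ δ ∈ Ioo 0 δ₀, D K ≤ W * ν (cthickening δ K) ^ (1 / q) := by
    rintro δ ⟨hδ, hδδ₀⟩
    have hTU : cthickening δ K ⊆ U := (cthickening_mono hδδ₀.le K).trans hδ₀U
    obtain ⟨t, x, ρ, hxρ, hcov, hsum⟩ :=
      hK.exists_finset_cover_sum_rpow_le (sub_nonneg.2 hp) hfin (half_pos hδ)
    obtain ⟨φ, hφd, hφ0, hφ1, hφs, hφ'⟩ := hC t x ρ fun i hi => (hxρ i hi).2.1
    have hφT : tsupport φ ⊆ cthickening δ K := hφs.trans <| iUnion₂_subset fun i hi =>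
      (closedBall_subset_closedBall (by linarith [(hxρ i hi).2.2])).trans
        (closedBall_subset_cthickening (hxρ i hi).1 δ)
    have hφc : HasCompactSupport φ := hK.cthickening.of_isClosed_subset (isClosed_tsupport φ) hφT
    have hφint : Integrable φ D := by
      obtain ⟨M, hM⟩ := hφc.exists_bound_of_continuous hφd.continuous
      rw [← integrableOn_iff_integrable_of_support_subset (subset_tsupport φ)]
      exact Measure.integrableOn_of_bounded (hDfin _ hφc (hφT.trans hTU)).ne
        hφd.continuous.aestronglyMeasurable (M := M) (ae_of_all _ hM)
    have hint : ∫⁻ z in U, ‖fderiv ℝ φ z‖ₑ * g z ∂μ =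
        ∫⁻ z in cthickening δ K, ‖fderiv ℝ φ z‖ₑ * g z ∂μ := by
      rw [← lintegral_inter_add_sdiff _ U isClosed_cthickening.measurableSet, inter_eq_right.2 hTU,
        setLIntegral_eq_zero (hU.measurableSet.diff isClosed_cthickening.measurableSet), add_zero]
      intro z hz
      have h0 : fderiv ℝ φ z = 0 := image_eq_zero_of_notMem_tsupport
        fun h => hz.2 (hφT (tsupport_fderiv_subset ℝ h))
      simp [← ofReal_norm, h0]
    have hgrad : ∫⁻ z in cthickening δ K, ‖fderiv ℝ φ z‖ₑ ^ p ∂μ ≤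
        ENNReal.ofReal (C * 2 ^ n) * μ (ball 0 1) * (μH[(n : ℝ) - p] K + 2) := by
      calc ∫⁻ z in cthickening δ K, ‖fderiv ℝ φ z‖ₑ ^ p ∂μ
          ≤ ∫⁻ z, ‖fderiv ℝ φ z‖ₑ ^ p ∂μ := lintegral_mono' Measure.restrict_le_self le_rfl
        _ ≤ ∫⁻ z, ∑ i ∈ t, (closedBall (x i) (2 * ρ i)).indicator
              (fun _ => ENNReal.ofReal (C * (ρ i)⁻¹ ^ p)) z ∂μ := by
            refine lintegral_mono fun z => ?_
            rw [← ofReal_norm, ENNReal.ofReal_rpow_of_nonneg (norm_nonneg _) hpq.nonneg]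
            refine (ENNReal.ofReal_le_ofReal (hφ' z)).trans ?_
            rw [Finset.mul_sum, ENNReal.ofReal_sum_of_nonneg]
            · refine Finset.sum_le_sum fun i _ => le_of_eq ?_
              by_cases hz : z ∈ closedBall (x i) (2 * ρ i)
              · simp only [indicator_of_mem hz]
              · simp only [indicator_of_notMem hz, mul_zero, ENNReal.ofReal_zero]
            · exact fun i hi => mul_nonneg hC0 (indicator_nonneg
                (fun _ _ => Real.rpow_nonneg (inv_nonneg.2 (hxρ i hi).2.1.le) _) _)
        _ = ∑ i ∈ t, ENNReal.ofReal (C * (ρ i)⁻¹ ^ p) * μ (closedBall (x i) (2 * ρ i)) := by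
            rw [lintegral_finsetSum _ fun i _ =>
              measurable_const.indicator isClosed_closedBall.measurableSet]
            refine Finset.sum_congr rfl fun i _ => ?_
            rw [lintegral_indicator_const isClosed_closedBall.measurableSet]
        _ = ENNReal.ofReal (C * 2 ^ n) * μ (ball 0 1) *
              ∑ i ∈ t, ENNReal.ofReal (ρ i) ^ ((n : ℝ) - p) := by
            rw [Finset.mul_sum]
            refine Finset.sum_congr rfl fun i hi => ?_
            have hρ := (hxρ i hi).2.1
            rw [Measure.addHaar_closedBall μ _ (by positivity), ← hn, ← mul_assoc,
              ← ENNReal.ofReal_mul (by positivity), ENNReal.ofReal_rpow_of_pos hρ, mul_right_comm _ (μ _),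
              ← ENNReal.ofReal_mul (by positivity)]
            congr 2
            rw [Real.rpow_sub hρ, Real.rpow_natCast, Real.inv_rpow hρ.le, mul_pow]
            ring
        _ ≤ _ := by gcongr
    calc D K = ∫⁻ _ in K, 1 ∂D := setLIntegral_one K |>.symm
      _ ≤ ∫⁻ z in K, ENNReal.ofReal (φ z) ∂D :=
          setLIntegral_mono' hK.measurableSet fun z hz => by rw [hφ1 z (hcov hz), ofReal_one]
      _ ≤ ∫⁻ z, ENNReal.ofReal (φ z) ∂D := lintegral_mono' Measure.restrict_le_self le_rfl
      _ = ENNReal.ofReal (∫ z, φ z ∂D) :=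
          (ofReal_integral_eq_lintegral_ofReal hφint (ae_of_all _ hφ0)).symm
      _ ≤ ∫⁻ z in U, ‖fderiv ℝ φ z‖ₑ * g z ∂μ := hD φ hφd hφc (hφT.trans hTU)
      _ = ∫⁻ z in cthickening δ K, ‖fderiv ℝ φ z‖ₑ * g z ∂μ := hint
      _ ≤ (∫⁻ z in cthickening δ K, ‖fderiv ℝ φ z‖ₑ ^ p ∂μ) ^ (1 / p) *
            (∫⁻ z in cthickening δ K, g z ^ q ∂μ) ^ (1 / q) :=
          ENNReal.lintegral_mul_le_Lp_mul_Lq _ hpq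
            (hφd.continuous_fderiv (by simp)).enorm.aemeasurable
            (hg.mono_measure (Measure.restrict_mono_set μ hTU))
      _ ≤ W * ν (cthickening δ K) ^ (1 / q) := by
          rw [hν δ hδδ₀.le]
          exact mul_le_mul_left (ENNReal.rpow_le_rpow hgrad (one_div_nonneg.2 hpq.nonneg)) _
  have hlim : Tendsto (fun δ => W * ν (cthickening δ K) ^ (1 / q)) (𝓝[>] 0) (𝓝 0) := by
    have h := ENNReal.Tendsto.const_mul (a := W) (((ENNReal.continuous_rpow_const
      (y := 1 / q)).tendsto _).comp ((tendsto_measure_cthickening_of_isCompact (μ := ν) hK).mono_left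
        (nhdsWithin_le_nhds (s := Ioi 0)))) (Or.inr hW)
    rwa [hνK, ENNReal.zero_rpow_of_pos (one_div_pos.2 hpq.symm.pos), mul_zero] at h
  exact le_antisymm (ge_of_tendsto hlim (eventually_of_mem (Ioo_mem_nhdsGT hδ₀) hmain)) (zero_le)

/-- general conservation laws, `(d+1)/d ≤ r < ∞`. Let `η ∈ L^r_loc`,
`Q ∈ L^r_loc` and `D` the entropy production measure, and set `s = d + 1 - r/(r-1)`. Then
every Borel set `B ⋐ Ω × (0,T)` with `H^s(B) < ∞` satisfies `D(B) = 0`; in particular, if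
`D ≠ 0` is concentrated on a set `S` then the Hausdorff dimension of `S` is at least `s`. -/
theorem stmt13 {d : ℕ} (hd : 1 ≤ d) (Ω : Set (Euc d)) (hΩ : IsOpen Ω) (T : ℝ) (hT : 0 < T)
    (r : ℝ) (hr : ((d : ℝ) + 1) / (d : ℝ) ≤ r)
    (η : Euc d × ℝ → ℝ) (Q : Euc d × ℝ → Euc d)
    (hη : MemLocLp Ω T η (ENNReal.ofReal r)) (hQ : MemLocLp Ω T Q (ENNReal.ofReal r))
    (D : Measure (Euc d × ℝ)) (hD : IsEntropyDissipation Ω T η Q D)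
    (s : ℝ) (hs : s = (d : ℝ) + 1 - r / (r - 1)) :
    (∀ B : Set (Euc d × ℝ), MeasurableSet B → IsCompact (closure B) →
      closure B ⊆ Ω ×ˢ Set.Ioo 0 T → μH[s] B < ⊤ → D B = 0) ∧
    (D ≠ 0 → ∀ S : Set (Euc d × ℝ), MeasurableSet S →
      (∀ A : Set (Euc d × ℝ), MeasurableSet A → D A = D (A ∩ S)) →
      ENNReal.ofReal s ≤ dimH S) := by
  set U : Set (Euc d × ℝ) := Ω ×ˢ Set.Ioo 0 T with hUdef
  have hU : IsOpen U := hΩ.prod isOpen_Ioo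
  have hd0 : (1 : ℝ) ≤ d := by exact_mod_cast hd
  have hdr : (d : ℝ) + 1 ≤ r * d := (div_le_iff₀ (by linarith)).1 hr
  have hr1 : 1 < r := by nlinarith
  have hpq : (r / (r - 1)).HolderConjugate r := (Real.HolderConjugate.conjExponent hr1).symm
  have hrank : Module.finrank ℝ (Euc d × ℝ) = d + 1 := by simp
  have hp : r / (r - 1) ≤ Module.finrank ℝ (Euc d × ℝ) := by
    rw [hrank, div_le_iff₀ (by linarith)]
    push_cast
    nlinarith
  have hs' : s = (Module.finrank ℝ (Euc d × ℝ) : ℝ) - r / (r - 1) := by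
    rw [hs, hrank]
    push_cast
    ring
  have : (volume : Measure (Euc d × ℝ)).IsAddHaarMeasure :=
    inferInstanceAs (Measure.IsAddHaarMeasure (volume.prod volume))
  obtain ⟨hDfin, hDU, hDφ⟩ := hD
  have hr0 : ENNReal.ofReal r ≠ 0 := (ENNReal.ofReal_pos.2 (by linarith)).ne'
  have hgm : AEStronglyMeasurable (fun z => ‖η z‖ + ‖Q z‖) (volume.restrict U) :=
    hη.1.norm.add hQ.1.norm
  have hgq : ∀ K, IsCompact K → K ⊆ U →
      ∫⁻ z in K, ‖‖η z‖ + ‖Q z‖‖ₑ ^ r < ⊤ := fun K hK hKU => by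
    have hle := Measure.restrict_mono_set (volume : Measure (Euc d × ℝ)) hKU
    have hmem : MemLp (fun z => ‖η z‖ + ‖Q z‖) (ENNReal.ofReal r) (volume.restrict K) :=
      MemLp.add (MemLp.norm ⟨hη.1.mono_measure hle, hη.2 K hK hKU⟩)
        (MemLp.norm ⟨hQ.1.mono_measure hle, hQ.2 K hK hKU⟩)
    simpa [ENNReal.toReal_ofReal (by linarith : 0 ≤ r)] using
      lintegral_rpow_enorm_lt_top_of_eLpNorm_lt_top hr0 ENNReal.ofReal_ne_top hmem.2
  have hkey : ∀ K, IsCompact K → K ⊆ U → μH[s] K < ⊤ → D K = 0 := by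
    intro K hK hKU hfin
    refine hK.measure_eq_zero_of_hausdorffMeasure_lt_top volume hpq hp hU hgm.enorm
      hgq hDfin (fun φ hφ hφc hφU => ?_) hKU (hs' ▸ hfin)
    rw [← hDφ φ hφ hφc hφU]
    refine (ENNReal.ofReal_le_ofReal (le_abs_self _)).trans ?_
    rw [← Real.norm_eq_abs, ofReal_norm]
    refine (enorm_integral_le_lintegral_enorm _).trans (lintegral_mono fun z => ?_)
    have hnn : 0 ≤ ‖η z‖ + ‖Q z‖ := by positivity
    rw [← enorm_norm (fderiv ℝ φ z), ← enorm_mul]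
    rw [enorm_le_iff_norm_le, norm_mul, norm_norm, Real.norm_of_nonneg hnn, mul_add]
    refine (norm_add_le _ _).trans (add_le_add ?_ ?_)
    · rw [norm_mul, mul_comm]
      gcongr
      exact (fderiv ℝ φ z).le_of_opNorm_le_of_le le_rfl (by simp) |>.trans_eq (mul_one _)
    · exact (fderiv ℝ φ z).le_of_opNorm_le_of_le le_rfl (by simp)
  have hB : ∀ B : Set (Euc d × ℝ), MeasurableSet B → IsCompact (closure B) →
      closure B ⊆ U → μH[s] B < ⊤ → D B = 0 := by
    intro B hBm hBc hBU hfin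
    have : IsFiniteMeasure (D.restrict (closure B)) :=
      ⟨by simpa using hDfin _ hBc hBU⟩
    rw [← Measure.restrict_eq_self D (subset_closure (s := B)),
      hBm.measure_eq_iSup_isCompact (D.restrict (closure B))]
    simp only [ENNReal.iSup_eq_zero]
    intro K hKB hK
    refine le_antisymm ((Measure.restrict_le_self K).trans_eq ?_) zero_le
    exact hkey K hK (hKB.trans (subset_closure.trans hBU)) ((measure_mono hKB).trans_lt hfin)
  refine ⟨hB, fun hDne S hS hconc => ?_⟩
  by_contra! hlt
  refine hDne (Measure.measure_univ_eq_zero.1 ?_)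
  rw [← union_compl_self U]
  refine measure_union_null (measure_null_of_locally_null U fun z hz => ?_) hDU
  obtain ⟨K, hKz, hKU, hK⟩ := local_compact_nhds (hU.mem_nhds hz)
  refine ⟨K, mem_nhdsWithin_of_mem_nhds hKz, ?_⟩
  have hcl : closure (K ∩ S) ⊆ K := hK.isClosed.closure_subset_iff.2 inter_subset_left
  rw [hconc K hK.measurableSet]
  refine hB _ (hK.measurableSet.inter hS) (hK.of_isClosed_subset isClosed_closure hcl)
    (hcl.trans hKU) ?_
  have hs0 : 0 ≤ s := hs' ▸ sub_nonneg.2 hp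
  have hH := hausdorffMeasure_of_dimH_lt (s := S) (d := s.toNNReal) hlt
  rw [Real.coe_toNNReal s hs0] at hH
  exact ((measure_mono inter_subset_right).trans_eq hH).trans_lt ENNReal.zero_lt_top
end
end

section
/- Let Ω ⊆ ℝ^d (d ≥ 1) be an open set and T > 0. Let η ∈ L^∞_loc(Ω×(0,T)) and Q ∈ L^∞_loc(Ω×(0,T); ℝ^d), and let D be a positive locally finite Borel measure on Ω×(0,T) such that for every φ ∈ C^∞_c(Ω×(0,T)): ∫₀^T∫_Ω [ η ∂_tφ + Q·∇φ ] dx dt = ∫ φ dD. Then D is absolutely continuous with respect to the d-dimensional Hausdorff measure H^d on ℝ^{d+1}. In particular, if D is non-trivial and concentrated on a space-time set S, then the Hausdorff dimension of S is at least d. -/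
open MeasureTheory Metric Set Filter Topology ENNReal

noncomputable section

/-- A smooth cutoff at scale `r` around any point, with gradient of order `r⁻¹`. -/
theorem exists_scaled_cutoff (E : Type*) [NormedAddCommGroup E] [NormedSpace ℝ E]
    [FiniteDimensional ℝ E] :
    ∃ C : ℝ, 0 ≤ C ∧ ∀ (z : E) (r : ℝ), 0 < r → ∃ φ : E → ℝ,
      ContDiff ℝ (⊤ : ℕ∞) φ ∧ (∀ w, 0 ≤ φ w) ∧ (∀ w, φ w ≤ 1) ∧
      (∀ w ∈ closedBall z r, φ w = 1) ∧ tsupport φ ⊆ closedBall z (2 * r) ∧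
      ∀ w, ‖fderiv ℝ φ w‖ ≤ C * r⁻¹ := by
  let χ : ContDiffBump (0 : E) := ⟨1, 2, one_pos, one_lt_two⟩
  have hχ : ContDiff ℝ (⊤ : ℕ∞) χ := χ.contDiff
  obtain ⟨C, hC⟩ := (χ.hasCompactSupport.fderiv (𝕜 := ℝ)).exists_bound_of_continuous
    (hχ.continuous_fderiv (by simp))
  refine ⟨C, (norm_nonneg _).trans (hC 0), fun z r hr => ?_⟩
  have hnorm : ∀ w : E, ‖r⁻¹ • (w - z)‖ = r⁻¹ * dist w z := fun w => by
    rw [norm_smul, Real.norm_of_nonneg (inv_nonneg.2 hr.le), dist_eq_norm]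
  refine ⟨fun w => χ (r⁻¹ • (w - z)), ?_, fun w => χ.nonneg, fun w => χ.le_one, ?_, ?_, ?_⟩
  · exact hχ.comp (contDiff_const.smul (contDiff_id.sub contDiff_const))
  · intro w hw
    refine χ.one_of_mem_closedBall ?_
    rw [mem_closedBall_zero_iff, hnorm, inv_mul_le_iff₀ hr]
    simpa [χ] using hw
  · refine closure_minimal (fun w hw => ?_) isClosed_closedBall
    have hmem : r⁻¹ • (w - z) ∈ ball (0 : E) 2 := by
      have : r⁻¹ • (w - z) ∈ Function.support χ := hw
      rwa [χ.support_eq] at this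
    rw [mem_ball_zero_iff, hnorm, inv_mul_lt_iff₀ hr] at hmem
    rw [mem_closedBall]
    linarith
  · intro w
    have hinner : HasFDerivAt (fun w : E => r⁻¹ • (w - z))
        (r⁻¹ • ContinuousLinearMap.id ℝ E) w :=
      ((hasFDerivAt_id w).sub_const z).const_smul r⁻¹
    have hcomp := ((hχ.differentiable (by simp)) (r⁻¹ • (w - z))).hasFDerivAt.comp w hinner
    have heq : fderiv ℝ (fun w => χ (r⁻¹ • (w - z))) w
        = r⁻¹ • fderiv ℝ χ (r⁻¹ • (w - z)) := by
      refine hcomp.fderiv.trans ?_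
      ext v
      simp
    rw [heq, norm_smul, Real.norm_of_nonneg (inv_nonneg.2 hr.le), mul_comm]
    exact mul_le_mul_of_nonneg_right (hC _) (inv_nonneg.2 hr.le)

/-- A function in `L^∞` of a compact set is almost everywhere bounded there. -/
theorem MemLocLp.exists_ae_bound {d : ℕ} {F : Type*} [NormedAddCommGroup F] {Ω : Set (Euc d)}
    {T : ℝ} {f : Euc d × ℝ → F} (hf : MemLocLp Ω T f ⊤) {K : Set (Euc d × ℝ)}
    (hK : IsCompact K) (hKU : K ⊆ Ω ×ˢ Set.Ioo 0 T) :
    ∃ M : ℝ, 0 ≤ M ∧ ∀ᵐ z ∂volume.restrict K, ‖f z‖ ≤ M := by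
  have hlt : eLpNormEssSup f (volume.restrict K) < ⊤ := by
    simpa [eLpNorm_exponent_top] using hf.2 K hK hKU
  refine ⟨(eLpNormEssSup f (volume.restrict K)).toReal, ENNReal.toReal_nonneg, ?_⟩
  filter_upwards [enorm_ae_le_eLpNormEssSup f (volume.restrict K)] with z hz
  simpa using ENNReal.toReal_mono hlt.ne hz

/-- The dissipation measure of a ball of radius `r` is `O(r^d)`, uniformly for balls whose
double lies in a fixed compact set. -/
theorem IsEntropyDissipation.exists_measure_closedBall_le {d : ℕ} {Ω : Set (Euc d)}
    (hΩ : IsOpen Ω) {T : ℝ} {η : Euc d × ℝ → ℝ} {Q : Euc d × ℝ → Euc d}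
    (hη : MemLocLp Ω T η ⊤) (hQ : MemLocLp Ω T Q ⊤) {D : Measure (Euc d × ℝ)}
    (hD : IsEntropyDissipation Ω T η Q D) {K : Set (Euc d × ℝ)}
    (hK : IsCompact K) (hKU : K ⊆ Ω ×ˢ Set.Ioo 0 T) :
    ∃ C : ℝ, 0 < C ∧ ∀ (z : Euc d × ℝ) (r : ℝ), 0 < r → closedBall z (2 * r) ⊆ K →
      D (closedBall z r) ≤ ENNReal.ofReal (C * r ^ d) := by
  obtain ⟨Mη, hMη, hηb⟩ := hη.exists_ae_bound hK hKU
  obtain ⟨MQ, hMQ, hQb⟩ := hQ.exists_ae_bound hK hKU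
  obtain ⟨C, hC, hcut⟩ := exists_scaled_cutoff (Euc d × ℝ)
  set V : ℝ := volume.real (ball (0 : Euc d × ℝ) 1)
  have hV : 0 ≤ V := measureReal_nonneg
  refine ⟨C * (Mη + MQ) * 2 ^ (d + 1) * V + 1, by positivity, fun z r hr hzK => ?_⟩
  obtain ⟨φ, hφ, hφ0, hφ1, hφone, hφsupp, hφd⟩ := hcut z r hr
  have hUm : MeasurableSet (Ω ×ˢ Set.Ioo 0 T) := (hΩ.prod isOpen_Ioo).measurableSet
  have hφc : HasCompactSupport φ :=
    HasCompactSupport.of_support_subset_isCompact (isCompact_closedBall z (2 * r))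
      ((subset_tsupport φ).trans hφsupp)
  have hweak := hD.2.2 φ hφ hφc (hφsupp.trans (hzK.trans hKU))
  have hball : volume.real (closedBall z (2 * r)) = (2 * r) ^ (d + 1) * V := by
    have : (volume : Measure (Euc d × ℝ)).IsAddHaarMeasure :=
      Measure.prod.instIsAddHaarMeasure (volume : Measure (Euc d)) (volume : Measure ℝ)
    rw [Measure.real, Measure.addHaar_closedBall _ _ (by positivity), ENNReal.toReal_mul,
      ENNReal.toReal_ofReal (by positivity)]
    simp [V, Measure.real]
  have hbound : ∫ z, φ z ∂D ≤ (C * (Mη + MQ) * 2 ^ (d + 1) * V) * r ^ d := by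
    rw [← hweak, setIntegral_eq_of_subset_of_forall_sdiff_eq_zero hUm (hzK.trans hKU)]
    · refine (Real.le_norm_self _).trans ((norm_setIntegral_le_of_norm_le_const_ae
        (C := C * r⁻¹ * (Mη + MQ)) measure_closedBall_lt_top ?_).trans_eq ?_)
      · filter_upwards [ae_restrict_of_ae_restrict_of_subset hzK hηb,
          ae_restrict_of_ae_restrict_of_subset hzK hQb] with w hw1 hw2
        have h1 : ‖(fderiv ℝ φ w) (0, 1)‖ ≤ C * r⁻¹ := by
          refine ((fderiv ℝ φ w).le_opNorm _).trans ?_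
          simpa [Prod.norm_def] using hφd w
        have h2 : ‖(fderiv ℝ φ w) (Q w, 0)‖ ≤ C * r⁻¹ * MQ := by
          refine ((fderiv ℝ φ w).le_opNorm _).trans ?_
          have : ‖((Q w, 0) : Euc d × ℝ)‖ = ‖Q w‖ := by simp [Prod.norm_def]
          rw [this]
          gcongr
          exact hφd w
        calc _ ≤ ‖η w‖ * ‖(fderiv ℝ φ w) (0, 1)‖ + ‖(fderiv ℝ φ w) (Q w, 0)‖ := by
              rw [← norm_mul]; exact norm_add_le _ _
          _ ≤ Mη * (C * r⁻¹) + C * r⁻¹ * MQ := by gcongr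
          _ = _ := by ring
      · rw [hball]
        field_simp
        ring
    · intro w hw
      have : fderiv ℝ φ w = 0 := by
        by_contra hne
        exact hw.2 (hφsupp (support_fderiv_subset ℝ hne))
      simp [this]
  have hint : Integrable φ D := by
    rw [← integrableOn_iff_integrable_of_support_subset
      (((subset_tsupport φ).trans hφsupp).trans hzK)]
    exact Measure.integrableOn_of_bounded (M := 1) (hD.1 K hK hKU).ne
      hφ.continuous.aestronglyMeasurable
      (Eventually.of_forall fun w => by simpa [abs_of_nonneg (hφ0 w)] using hφ1 w)
  calc D (closedBall z r) = ∫⁻ w in closedBall z r, 1 ∂D := by simp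
    _ ≤ ∫⁻ w in closedBall z r, ENNReal.ofReal (φ w) ∂D :=
        setLIntegral_mono' isClosed_closedBall.measurableSet fun w hw => by simp [hφone w hw]
    _ ≤ ∫⁻ w, ENNReal.ofReal (φ w) ∂D := setLIntegral_le_lintegral _ _
    _ = ENNReal.ofReal (∫ w, φ w ∂D) :=
        (ofReal_integral_eq_lintegral_ofReal hint (Eventually.of_forall hφ0)).symm
    _ ≤ _ := by
        refine ENNReal.ofReal_le_ofReal (hbound.trans ?_)
        gcongr
        linarith

/-- A measure with `μ (closedBall z r) ≤ C r^d` for centres in `K` and small radii does not charge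
`H^d`-null subsets of `K`. -/
theorem measure_inter_eq_zero_of_closedBall_le {X : Type*} [MetricSpace X] [MeasurableSpace X]
    [BorelSpace X] {μ : Measure X} {d : ℕ} {K : Set X} (hK : MeasurableSet K)
    {C δ : ℝ} (hC : 0 < C) (hδ : 0 < δ)
    (h : ∀ z ∈ K, ∀ r : ℝ, 0 < r → r ≤ δ → μ (closedBall z r) ≤ ENNReal.ofReal (C * r ^ d))
    {A : Set X} (hA : μH[(d : ℝ)] A = 0) : μ (A ∩ K) = 0 := by
  have hc0 : ENNReal.ofReal C ≠ 0 := by simpa using hC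
  have hle : (ENNReal.ofReal C)⁻¹ • μ.restrict K ≤ μH[(d : ℝ)] := by
    refine Measure.le_hausdorffMeasure _ _ (ENNReal.ofReal δ) (by simpa using hδ)
      fun s hs => ?_
    rw [Measure.smul_apply, smul_eq_mul, ENNReal.inv_mul_le_iff hc0 ENNReal.ofReal_ne_top,
      Measure.restrict_apply' hK]
    rcases (s ∩ K).eq_empty_or_nonempty with he | ⟨z, hzs, hzK⟩
    · simp [he]
    have hfin : ediam s ≠ ⊤ := ne_top_of_le_ne_top ENNReal.ofReal_ne_top hs
    have hdiam : diam s ≤ δ := ENNReal.toReal_le_of_le_ofReal hδ.le hs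
    have hsub : ∀ r, diam s ≤ r → s ⊆ closedBall z r := fun r hr w hw =>
      (dist_le_diam_of_mem (isBounded_iff_ediam_ne_top.2 hfin) hw hzs).trans hr
    have hpow : ENNReal.ofReal (C * diam s ^ d) = ENNReal.ofReal C * ediam s ^ (d : ℝ) := by
      rw [ENNReal.ofReal_mul hC.le, ENNReal.ofReal_pow diam_nonneg, diam,
        ENNReal.ofReal_toReal hfin, ENNReal.rpow_natCast]
    rw [← hpow]
    rcases (diam_nonneg (s := s)).eq_or_lt with h0 | hpos
    · rw [← h0]
      have hcont : ContinuousAt (fun r : ℝ => ENNReal.ofReal (C * r ^ d)) 0 := by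
        exact (ENNReal.continuous_ofReal.comp (by fun_prop)).continuousAt
      refine ge_of_tendsto (hcont.tendsto.mono_left (nhdsWithin_le_nhds (s := Ioi 0))) ?_
      filter_upwards [Ioc_mem_nhdsGT hδ] with r hr
      exact (measure_mono (inter_subset_left.trans (hsub r (h0 ▸ hr.1.le)))).trans
        (h z hzK r hr.1 hr.2)
    · exact (measure_mono (inter_subset_left.trans (hsub _ le_rfl))).trans
        (h z hzK _ hpos hdiam)
  have hzero : ((ENNReal.ofReal C)⁻¹ • μ.restrict K) A = 0 :=
    le_antisymm ((hle A).trans_eq hA) zero_le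
  simpa [Measure.restrict_apply' hK] using hzero

/-- Entropy dissipation of bounded solutions does not charge `H^d`-null sets. -/
theorem IsEntropyDissipation.measure_eq_zero {d : ℕ} {Ω : Set (Euc d)}
    (hΩ : IsOpen Ω) {T : ℝ} {η : Euc d × ℝ → ℝ} {Q : Euc d × ℝ → Euc d}
    (hη : MemLocLp Ω T η ⊤) (hQ : MemLocLp Ω T Q ⊤) {D : Measure (Euc d × ℝ)}
    (hD : IsEntropyDissipation Ω T η Q D) {A : Set (Euc d × ℝ)}
    (hA : μH[(d : ℝ)] A = 0) : D A = 0 := by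
  have hU : IsOpen (Ω ×ˢ Set.Ioo 0 T) := hΩ.prod isOpen_Ioo
  have hcompact : ∀ K : Set (Euc d × ℝ), IsCompact K → K ⊆ Ω ×ˢ Set.Ioo 0 T →
      D (A ∩ K) = 0 := by
    intro K hK hKU
    obtain ⟨δ, hδ, hδU⟩ := hK.exists_cthickening_subset_open hU hKU
    obtain ⟨C, hC, hball⟩ :=
      hD.exists_measure_closedBall_le hΩ hη hQ hK.cthickening hδU
    refine measure_inter_eq_zero_of_closedBall_le hK.measurableSet hC (half_pos hδ)
      (fun z hz r hr hrδ => hball z r hr ?_) hA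
    exact (closedBall_subset_closedBall (by linarith)).trans
      (closedBall_subset_cthickening hz δ)
  have hcover : ∃ K : ℕ → Set (Euc d × ℝ),
      (∀ n, IsCompact (K n)) ∧ ⋃ n, K n = Ω ×ˢ Set.Ioo 0 T := by
    have : SigmaCompactSpace ↥(Ω ×ˢ Set.Ioo 0 T) :=
      have := hU.locallyCompactSpace
      inferInstance
    exact isSigmaCompact_iff_sigmaCompactSpace.2 this
  obtain ⟨K, hK, hKU⟩ := hcover
  have hsub : A ⊆ (Ω ×ˢ Set.Ioo 0 T)ᶜ ∪ ⋃ n, A ∩ K n := by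
    intro z hz
    by_cases hzU : z ∈ Ω ×ˢ Set.Ioo 0 T
    · rw [← inter_iUnion, hKU]
      exact Or.inr ⟨hz, hzU⟩
    · exact Or.inl hzU
  refine measure_mono_null hsub (measure_union_null hD.2.1 (measure_iUnion_null fun n => ?_))
  exact hcompact _ (hK n) (hKU ▸ subset_iUnion K n)

/-- general conservation laws, bounded solutions. Let `η ∈ L^∞_loc`,
`Q ∈ L^∞_loc` and `D` the entropy production measure. Then `D` is absolutely continuous
with respect to the `d`-dimensional Hausdorff measure `H^d` on `ℝ^{d+1}`; in particular,
if `D ≠ 0` is concentrated on a set `S` then the Hausdorff dimension of `S` is at least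
`d`. -/
theorem stmt14 {d : ℕ} (hd : 1 ≤ d) (Ω : Set (Euc d)) (hΩ : IsOpen Ω) (T : ℝ) (hT : 0 < T)
    (η : Euc d × ℝ → ℝ) (Q : Euc d × ℝ → Euc d)
    (hη : MemLocLp Ω T η ⊤) (hQ : MemLocLp Ω T Q ⊤)
    (D : Measure (Euc d × ℝ)) (hD : IsEntropyDissipation Ω T η Q D) :
    (∀ A : Set (Euc d × ℝ), MeasurableSet A → μH[(d : ℝ)] A = 0 → D A = 0) ∧
    (D ≠ 0 → ∀ S : Set (Euc d × ℝ), MeasurableSet S →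
      (∀ A : Set (Euc d × ℝ), MeasurableSet A → D A = D (A ∩ S)) →
      (d : ℝ≥0∞) ≤ dimH S) := by
  refine ⟨fun A _ hA => hD.measure_eq_zero hΩ hη hQ hA, fun hD0 S _ hS => ?_⟩
  by_contra! hlt
  have hnull : μH[(d : ℝ)] S = 0 := by
    have := hausdorffMeasure_of_dimH_lt (s := S) (d := (d : NNReal)) (by simpa using hlt)
    simpa using this
  refine hD0 (Measure.measure_univ_eq_zero.1 ?_)
  rw [hS univ MeasurableSet.univ, univ_inter]
  exact hD.measure_eq_zero hΩ hη hQ hnull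
end
end
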